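/- Let W_b be a symmetrized joint channel (successive form, D-value representation) with upgrade-couple channel Ŵ_b. Then the canonical b-channel marginals of Ŵ_b and W_b coincide: Σ_{y_a,u_a,i,j} Ŵ_b(y_a^{i,j},u_a,d_b|u_b) = Σ_{y_a,u_a} W_b(y_a,u_a,d_b|u_b) for every d_b and u_b; and the canonical a-channel marginals coincide: for every a-channel D-value d_a, the total probability under Ŵ_a of a-outputs y_a^{i,j} whose a-channel D-value is d_a equals the total probability under W_a of a-outputs y_a whose a-channel D-value is d_a, for each input bit. -/

import Mathlib

open Finset

/-- `W y u` is the probability that the channel outputs `y` given input `u`. -/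
def IsChannel {Y U : Type*} [Fintype Y] (W : Y → U → ℝ) : Prop :=
  (∀ y u, 0 ≤ W y u) ∧ ∀ u, ∑ y, W y u = 1

/-- A randomized decoder: `φ y u` is the probability of declaring `u` upon observing `y`. -/
def IsDecoder {Y : Type*} (φ : Y → Bool → ℝ) : Prop :=
  (∀ y u, 0 ≤ φ y u) ∧ ∀ y, ∑ u, φ y u = 1

/-- A joint channel with two binary inputs and outputs in `Ya × Yb`. -/
def IsJointChannel {Ya Yb : Type*} [Fintype Ya] [Fintype Yb]
    (W : Ya → Yb → Bool → Bool → ℝ) : Prop :=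
  (∀ ya yb ua ub, 0 ≤ W ya yb ua ub) ∧ ∀ ua ub, ∑ ya, ∑ yb, W ya yb ua ub = 1

/-- a-channel marginal of a joint channel (inputs equiprobable). -/
noncomputable def margA {Ya Yb : Type*} [Fintype Ya] [Fintype Yb]
    (W : Ya → Yb → Bool → Bool → ℝ) (ya : Ya) (ua : Bool) : ℝ :=
  (1 / 2) * ∑ ub, ∑ yb, W ya yb ua ub

/-- b-channel marginal of a joint channel (inputs equiprobable). -/
noncomputable def margB {Ya Yb : Type*} [Fintype Ya] [Fintype Yb]
    (W : Ya → Yb → Bool → Bool → ℝ) (yb : Yb) (ub : Bool) : ℝ :=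
  (1 / 2) * ∑ ua, ∑ ya, W ya yb ua ub

/-- `P(E_a ∪ E_b)`: the probability that at least one of the two decoders errs. -/
noncomputable def PerrUnion {Ya Yb : Type*} [Fintype Ya] [Fintype Yb]
    (W : Ya → Yb → Bool → Bool → ℝ)
    (φa : Ya → Bool → ℝ) (φb : Yb → Bool → ℝ) : ℝ :=
  1 - (1 / 4) * ∑ ua, ∑ ub, ∑ ya, ∑ yb, W ya yb ua ub * φa ya ua * φb yb ub

/-- Successive form: the b-output is `(y_a, u_a, y_r)` with probability one. -/
def SuccessiveForm {Ya Yr : Type*} [Fintype Ya] [Fintype Yr] [DecidableEq Ya]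
    (W : Ya → Ya × Bool × Yr → Bool → Bool → ℝ) : Prop :=
  ∀ ya ya' ua' yr ua ub,
    W ya (ya', ua', yr) ua ub =
      if ya' = ya ∧ ua' = ua then 2 * margB W (ya, ua, yr) ub else 0

/-- A maximum-likelihood decoder for the binary-input channel `V`. -/
def IsMLDecoder {Y : Type*} (V : Y → Bool → ℝ) (φ : Y → Bool → ℝ) : Prop :=
  ∀ y u, 0 < φ y u → V y u = max (V y false) (V y true)

/-- `W` is stochastically degraded from `Q`. -/
def Degraded {Y Z U : Type*} [Fintype Y] [Fintype Z]
    (W : Y → U → ℝ) (Q : Z → U → ℝ) : Prop :=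
  ∃ P : Z → Y → ℝ,
    (∀ z y, 0 ≤ P z y) ∧ (∀ z, ∑ y, P z y = 1) ∧
    ∀ y u, W y u = ∑ z, P z y * Q z u

/-- `Q` is properly upgraded from `W` (both joint channels in successive form). -/
def ProperUpgrade {Ya Yr Za Zr : Type*}
    [Fintype Ya] [Fintype Yr] [Fintype Za] [Fintype Zr]
    (Q : Za → Za × Bool × Zr → Bool → Bool → ℝ)
    (W : Ya → Ya × Bool × Yr → Bool → Bool → ℝ) : Prop :=
  ∃ (Pa : Za → Ya → ℝ) (Pb : Za → Bool → Zr → Ya → Yr → ℝ),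
    (∀ za ya, 0 ≤ Pa za ya) ∧ (∀ za, ∑ ya, Pa za ya = 1) ∧
    (∀ za ua zr ya yr, 0 ≤ Pb za ua zr ya yr) ∧
    (∀ za ua zr ya, ∑ yr, Pb za ua zr ya yr = 1) ∧
    ∀ ya ua yr ub,
      margB W (ya, ua, yr) ub =
        ∑ za, ∑ zr, Pa za ya * Pb za ua zr ya yr * margB Q (za, ua, zr) ub

/-- The minimum over decoder pairs of `P(E_a ∪ E_b)`. -/
noncomputable def PeIMJP {Ya Yb : Type*} [Fintype Ya] [Fintype Yb]
    (W : Ya → Yb → Bool → Bool → ℝ) : ℝ :=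
  sInf {p : ℝ | ∃ φa φb, IsDecoder φa ∧ IsDecoder φb ∧ p = PerrUnion W φa φb}

/-- Error probability of an ML decoder for a binary-input channel with equiprobable inputs. -/
noncomputable def PeML {Y : Type*} [Fintype Y] (V : Y → Bool → ℝ) : ℝ :=
  1 - (1 / 2) * ∑ y, max (V y false) (V y true)

/-- The `D`-value of an output of a binary-input channel. -/
noncomputable def dval {Y : Type*} (V : Y → Bool → ℝ) (y : Y) : ℝ :=
  (V y false - V y true) / (V y false + V y true)

/-- D-value representation: the third component of each positive-probability b-output
is its b-channel D-value (`v` gives the real value of a rest symbol). -/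
def DvalRepJoint {Ya R : Type*} [Fintype Ya] [Fintype R]
    (W : Ya → Ya × Bool × R → Bool → Bool → ℝ) (v : R → ℝ) : Prop :=
  ∀ ya ua r,
    0 < margB W (ya, ua, r) false + margB W (ya, ua, r) true →
    v r = dval (margB W) (ya, ua, r)

/-- A symmetrized joint channel (successive form, D-value representation). -/
def SymmetrizedJoint {Ya R : Type*} [Fintype Ya] [Fintype R]
    (W : Ya → Ya × Bool × R → Bool → Bool → ℝ)
    (v : R → ℝ) (bar : Ya → Ya) (neg : R → R) : Prop :=
  Function.Involutive bar ∧ Function.Involutive neg ∧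
  (∀ r, v (neg r) = -v r) ∧
  (∀ ya ua, margA W ya ua = margA W (bar ya) (!ua)) ∧
  (∀ ya ua r ub,
    margB W (ya, ua, r) ub = margB W (bar ya, !ua, r) ub ∧
    margB W (ya, ua, r) ub = margB W (ya, ua, neg r) (!ub) ∧
    margB W (ya, ua, r) ub = margB W (bar ya, !ua, neg r) (!ub))

/-- A decoupling decomposition `W_b = (1/2)·W_a·W_2` of a symmetrized joint channel. -/
def DecouplingDecomp {Ya R : Type*} [Fintype Ya] [Fintype R]
    (W : Ya → Ya × Bool × R → Bool → Bool → ℝ)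
    (W2 : R → Bool → Ya → Bool → ℝ) : Prop :=
  (∀ r ub ya ua, 0 ≤ W2 r ub ya ua) ∧
  (∀ ya ua ub, ∑ r, W2 r ub ya ua = 1) ∧
  ∀ ya ua r ub, margB W (ya, ua, r) ub = (1 / 2) * margA W ya ua * W2 r ub ya ua

/-- The real value of a signed D-value symbol: `(s, i)` stands for `+d_{bi}` if `s = false`
and `−d_{bi}` if `s = true`. -/
noncomputable def vD {B : ℕ} (dB : Fin B → ℝ) : Bool × Fin B → ℝ :=
  fun r => if r.1 then -dB r.2 else dB r.2

/-- Negation (conjugation) of a signed D-value symbol. -/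
def negD {B : ℕ} : Bool × Fin B → Bool × Fin B := fun r => (!r.1, r.2)

/-- The splitting factor `S_{i,j}(y_a, u_a, d_b)` of the upgrade-couple transform. -/
noncomputable def Sfac {Ya : Type*} {B : ℕ}
    (W2 : Bool × Fin B → Bool → Ya → Bool → ℝ)
    (i j : Fin B) (ya : Ya) (ua : Bool) (r : Bool × Fin B) : ℝ :=
  if ua = false then
    (if r.2 = i then ∑ ub, W2 (false, j) ub ya true else 0)
  else
    (if r.2 = j then ∑ ub, W2 (false, i) ub ya false else 0)

/-- `α_{i,j}(y_a) = S_{i,j}(y_a,0,d_{bi}) · S_{i,j}(y_a,1,d_{bj})`. -/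
noncomputable def alphaFac {Ya : Type*} {B : ℕ}
    (W2 : Bool × Fin B → Bool → Ya → Bool → ℝ) (i j : Fin B) (ya : Ya) : ℝ :=
  Sfac W2 i j ya false (false, i) * Sfac W2 i j ya true (false, j)

/-- The upgrade-couple joint channel `Ŵ_{a,b}`, in successive form, with a-outputs
`y_a^{i,j} = (y_a, i, j)` and b-marginal
`Ŵ_b(y_a^{i,j}, u_a, d_b | u_b) = W_b(y_a, u_a, d_b | u_b) · S_{i,j}(y_a, u_a, d_b)`. -/
noncomputable def upgradeCouple {Ya : Type*} [Fintype Ya] [DecidableEq Ya] {B : ℕ}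
    (W : Ya → Ya × Bool × (Bool × Fin B) → Bool → Bool → ℝ)
    (W2 : Bool × Fin B → Bool → Ya → Bool → ℝ) :
    Ya × Fin B × Fin B →
      (Ya × Fin B × Fin B) × Bool × (Bool × Fin B) → Bool → Bool → ℝ :=
  fun p q ua ub =>
    if q.1 = p ∧ q.2.1 = ua then
      2 * (margB W (p.1, ua, q.2.2) ub * Sfac W2 p.2.1 p.2.2 p.1 ua q.2.2)
    else 0

/-- The weight `Σ_{u_b} W_2(d_{bk}|u_b; y_a, u_a)` of the magnitude `d_{bk}`. -/
noncomputable def magWeight {Ya : Type*} {B : ℕ}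
    (W2 : Bool × Fin B → Bool → Ya → Bool → ℝ) (k : Fin B) (ya : Ya) (ua : Bool) : ℝ :=
  ∑ ub, W2 (false, k) ub ya ua

section UpgradeCouple

variable {Ya : Type*} {B : ℕ}

lemma Sfac_eq_magWeight (W2 : Bool × Fin B → Bool → Ya → Bool → ℝ)
    (i j : Fin B) (ya : Ya) (ua : Bool) (r : Bool × Fin B) :
    Sfac W2 i j ya ua r =
      if ua = false then (if r.2 = i then magWeight W2 j ya true else 0)
      else (if r.2 = j then magWeight W2 i ya false else 0) :=
  rfl

lemma W2_true_eq {W2 : Bool × Fin B → Bool → Ya → Bool → ℝ}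
    (hneg : ∀ r ub ya ua, W2 (negD r) (!ub) ya ua = W2 r ub ya ua)
    (k : Fin B) (ub : Bool) (ya : Ya) (ua : Bool) :
    W2 (true, k) ub ya ua = W2 (false, k) (!ub) ya ua := by
  simpa [negD] using (hneg (true, k) ub ya ua).symm

lemma sum_magWeight {W2 : Bool × Fin B → Bool → Ya → Bool → ℝ}
    (hneg : ∀ r ub ya ua, W2 (negD r) (!ub) ya ua = W2 r ub ya ua)
    (hsum : ∀ ya ua ub, ∑ r, W2 r ub ya ua = 1) (ya : Ya) (ua : Bool) :
    ∑ k, magWeight W2 k ya ua = 1 := by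
  have h := hsum ya ua false
  rw [Fintype.sum_prod_type_right] at h
  rw [← h]
  refine Finset.sum_congr rfl fun k _ => ?_
  simp only [magWeight, Fintype.sum_bool, W2_true_eq hneg, Bool.not_false]

lemma sum_Sfac {W2 : Bool × Fin B → Bool → Ya → Bool → ℝ}
    (hneg : ∀ r ub ya ua, W2 (negD r) (!ub) ya ua = W2 r ub ya ua)
    (hsum : ∀ ya ua ub, ∑ r, W2 r ub ya ua = 1)
    (ya : Ya) (ua : Bool) (r : Bool × Fin B) :
    ∑ i, ∑ j, Sfac W2 i j ya ua r = 1 := by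
  cases ua
  · rw [Finset.sum_comm]
    simp [Sfac_eq_magWeight, sum_magWeight hneg hsum]
  · simp [Sfac_eq_magWeight, sum_magWeight hneg hsum]

variable [Fintype Ya] [DecidableEq Ya]

lemma margB_upgradeCouple (W : Ya → Ya × Bool × (Bool × Fin B) → Bool → Bool → ℝ)
    (W2 : Bool × Fin B → Bool → Ya → Bool → ℝ)
    (p : Ya × Fin B × Fin B) (ua : Bool) (r : Bool × Fin B) (ub : Bool) :
    margB (upgradeCouple W W2) (p, ua, r) ub =
      margB W (p.1, ua, r) ub * Sfac W2 p.2.1 p.2.2 p.1 ua r := by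
  rw [margB, Finset.sum_eq_single ua (by simp +contextual [upgradeCouple, eq_comm]) (by simp),
    Finset.sum_eq_single p (by simp +contextual [upgradeCouple, eq_comm]) (by simp)]
  simp [upgradeCouple]

lemma margA_upgradeCouple_eq_sum (W : Ya → Ya × Bool × (Bool × Fin B) → Bool → Bool → ℝ)
    (W2 : Bool × Fin B → Bool → Ya → Bool → ℝ) (p : Ya × Fin B × Fin B) (ua : Bool) :
    margA (upgradeCouple W W2) p ua =
      ∑ ub, ∑ r, margB W (p.1, ua, r) ub * Sfac W2 p.2.1 p.2.2 p.1 ua r := by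
  rw [margA, Finset.mul_sum]
  refine Finset.sum_congr rfl fun ub _ => ?_
  rw [Fintype.sum_prod_type, Finset.sum_eq_single p
    (fun q _ hq => by simp [upgradeCouple, hq]) (by simp), Fintype.sum_prod_type,
    Finset.sum_eq_single ua (fun u _ hu => by simp [upgradeCouple, hu]) (by simp)]
  simp [upgradeCouple, ← Finset.mul_sum]

lemma margA_upgradeCouple {W : Ya → Ya × Bool × (Bool × Fin B) → Bool → Bool → ℝ}
    {W2 : Bool × Fin B → Bool → Ya → Bool → ℝ}
    (hneg : ∀ r ub ya ua, W2 (negD r) (!ub) ya ua = W2 r ub ya ua)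
    (hdec : DecouplingDecomp W W2) (p : Ya × Fin B × Fin B) (ua : Bool) :
    margA (upgradeCouple W W2) p ua =
      margA W p.1 ua * (magWeight W2 p.2.1 p.1 false * magWeight W2 p.2.2 p.1 true) := by
  rw [margA_upgradeCouple_eq_sum]
  simp only [hdec.2.2, Sfac_eq_magWeight, Fintype.sum_prod_type]
  cases ua <;>
  · simp [W2_true_eq hneg]
    simp only [magWeight, Fintype.sum_bool]
    ring

lemma dval_upgradeCouple {W : Ya → Ya × Bool × (Bool × Fin B) → Bool → Bool → ℝ}
    {W2 : Bool × Fin B → Bool → Ya → Bool → ℝ}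
    (hneg : ∀ r ub ya ua, W2 (negD r) (!ub) ya ua = W2 r ub ya ua)
    (hdec : DecouplingDecomp W W2) (p : Ya × Fin B × Fin B)
    (hp : magWeight W2 p.2.1 p.1 false * magWeight W2 p.2.2 p.1 true ≠ 0) :
    dval (margA (upgradeCouple W W2)) p = dval (margA W) p.1 := by
  simp only [dval, margA_upgradeCouple hneg hdec, ← sub_mul, ← add_mul]
  exact mul_div_mul_right _ _ hp

end UpgradeCouple

/-- The canonical marginals of the upgrade-couple channel coincide with
those of the original channel: for every b-symbol `d_b` and input `u_b`,
`Σ_{y_a,u_a,i,j} Ŵ_b(y_a^{i,j},u_a,d_b|u_b) = Σ_{y_a,u_a} W_b(y_a,u_a,d_b|u_b)`, and for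
every a-channel D-value `d_a` and input bit, the total a-channel probability of a-outputs
with D-value `d_a` is the same for `Ŵ_a` and `W_a`. -/
theorem stmt16 {Ya : Type*} [Fintype Ya] [DecidableEq Ya] {B : ℕ}
    (W : Ya → Ya × Bool × (Bool × Fin B) → Bool → Bool → ℝ)
    (dB : Fin B → ℝ) (bar : Ya → Ya)
    (hW : IsJointChannel W) (hsucc : SuccessiveForm W)
    (hdB0 : ∀ i, 0 ≤ dB i) (hdBmono : Monotone dB)
    (hrep : DvalRepJoint W (vD dB))
    (hsym : SymmetrizedJoint W (vD dB) bar negD)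
    (W2 : Bool × Fin B → Bool → Ya → Bool → ℝ)
    (hdec : DecouplingDecomp W W2)
    (hW2neg : ∀ r ub ya ua, W2 (negD r) (!ub) ya ua = W2 r ub ya ua)
    (hW2bar : ∀ r ub ya ua, W2 r ub (bar ya) (!ua) = W2 r ub ya ua) :
    (∀ r ub,
      (∑ ua, ∑ p : Ya × Fin B × Fin B, margB (upgradeCouple W W2) (p, ua, r) ub) =
        ∑ ua, ∑ ya, margB W (ya, ua, r) ub) ∧
    (∀ (da : ℝ) (ua : Bool),
      (∑ p ∈ Finset.univ.filter
          (fun p : Ya × Fin B × Fin B => dval (margA (upgradeCouple W W2)) p = da),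
        margA (upgradeCouple W W2) p ua) =
      ∑ ya ∈ Finset.univ.filter (fun ya : Ya => dval (margA W) ya = da),
        margA W ya ua) := by
  constructor
  · intro r ub
    refine Finset.sum_congr rfl fun ua _ => ?_
    rw [Fintype.sum_prod_type]
    refine Finset.sum_congr rfl fun ya _ => ?_
    simp only [margB_upgradeCouple, ← Finset.mul_sum, Fintype.sum_prod_type]
    rw [sum_Sfac hW2neg hdec.2.1, mul_one]
  · intro da ua
    have key : ∀ p : Ya × Fin B × Fin B,
        (if dval (margA (upgradeCouple W W2)) p = da then
          margA (upgradeCouple W W2) p ua else 0) =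
        (if dval (margA W) p.1 = da then margA W p.1 ua else 0) *
          (magWeight W2 p.2.1 p.1 false * magWeight W2 p.2.2 p.1 true) := by
      intro p
      by_cases hp : magWeight W2 p.2.1 p.1 false * magWeight W2 p.2.2 p.1 true = 0
      · rw [margA_upgradeCouple hW2neg hdec, hp]
        simp
      · rw [dval_upgradeCouple hW2neg hdec p hp, margA_upgradeCouple hW2neg hdec, ite_mul,
          zero_mul]
    rw [Finset.sum_filter, Finset.sum_filter, Fintype.sum_prod_type]
    refine Finset.sum_congr rfl fun ya _ => ?_
    simp only [key, ← Finset.mul_sum, Fintype.sum_prod_type]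
    simp only [sum_magWeight hW2neg hdec.2.1, mul_one]
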